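/- If |[n_1, …, n_l]| = |[n_2, …, n_l]| + 1 (i.e. q = q_1 + 1), then n_i = 2 for all 1 ≤ i ≤ l; that is, [n_1, …, n_l] = [2, …, 2]. -/

import Mathlib

/-- The `l × l` symmetric tridiagonal intersection matrix `M(-n₁, …, -n_l)`,
where the entries `n 1, …, n l` of `n : ℕ → ℤ` are used (1-based indexing). -/
def HJMat (l : ℕ) (n : ℕ → ℤ) : Matrix (Fin l) (Fin l) ℤ :=
  Matrix.of fun i j =>
    if i = j then -(n (i.val + 1))
    else if i.val + 1 = j.val ∨ j.val + 1 = i.val then 1 else 0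

/-- `|[n₁, …, n_l]| = |det M(-n₁, …, -n_l)|` (with `|[]| = 1` for `l = 0`). -/
def HJdet (l : ℕ) (n : ℕ → ℤ) : ℤ := |(HJMat l n).det|

/-- `u`-sequence: `u 0 = 0` and `u s = |[n₁, …, n_{s-1}]|` for `s ≥ 1`. -/
def HJu (n : ℕ → ℤ) : ℕ → ℤ
  | 0 => 0
  | s + 1 => HJdet s n

/-- `v`-sequence: `v s = |[n_{s+1}, …, n_l]|` for `0 ≤ s ≤ l`, and `v s = 0` for `s > l`. -/
def HJv (l : ℕ) (n : ℕ → ℤ) (s : ℕ) : ℤ :=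
  if s ≤ l then HJdet (l - s) (fun i => n (s + i)) else 0

/-- `q = |[n₁, …, n_l]|`. -/
def HJq (l : ℕ) (n : ℕ → ℤ) : ℤ := HJdet l n

theorem HJMat_submatrix_succ (l : ℕ) (n : ℕ → ℤ) :
    (HJMat (l + 1) n).submatrix Fin.succ Fin.succ = HJMat l (fun i => n (1 + i)) := by
  ext i j
  simp only [HJMat, Matrix.submatrix_apply, Matrix.of_apply, Fin.succ_inj, Fin.val_succ,
    add_left_inj, add_comm 1]

theorem HJMat_det_add_two (l : ℕ) (n : ℕ → ℤ) :
    (HJMat (l + 2) n).det = -n 1 * (HJMat (l + 1) (fun i => n (1 + i))).det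
      - (HJMat l (fun i => n (1 + (1 + i)))).det := by
  have minor : ((HJMat (l + 2) n).submatrix Fin.succ (Fin.succAbove 1)).det
      = (HJMat l (fun i => n (1 + (1 + i)))).det := by
    rw [Matrix.det_succ_column_zero, Fin.sum_univ_succ, Finset.sum_eq_zero]
    · have hsub : ((HJMat (l + 2) n).submatrix Fin.succ (Fin.succAbove 1)).submatrix
          (Fin.succAbove 0) Fin.succ = HJMat l (fun i => n (1 + (1 + i))) := by
        rw [← HJMat_submatrix_succ l (fun i => n (1 + i)), ← HJMat_submatrix_succ (l + 1) n]
        ext i j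
        simp
      rw [hsub]
      simp [HJMat]
    · intro i _
      simp [HJMat, Fin.ext_iff]
  rw [Matrix.det_succ_row_zero, Fin.sum_univ_succ, Fin.sum_univ_succ, Finset.sum_eq_zero]
  · have hsub : (HJMat (l + 2) n).submatrix Fin.succ (Fin.succAbove 0)
        = HJMat (l + 1) (fun i => n (1 + i)) := by
      rw [← HJMat_submatrix_succ, Fin.succAbove_zero]
    rw [hsub, Fin.succ_zero_eq_one, minor]
    simp [HJMat]
    ring
  · intro i _
    simp [HJMat, Fin.ext_iff]

theorem HJMat_signed_det_pos_and_lt (l : ℕ) (n : ℕ → ℤ) (hn : ∀ i, 1 ≤ i → i ≤ l + 1 → 2 ≤ n i) :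
    0 < (-1) ^ l * (HJMat l (fun i => n (1 + i))).det ∧
      (-1) ^ l * (HJMat l (fun i => n (1 + i))).det < (-1) ^ (l + 1) * (HJMat (l + 1) n).det := by
  induction l generalizing n with
  | zero =>
    have := hn 1 le_rfl le_rfl
    simp [HJMat]
    linarith
  | succ l ih =>
    obtain ⟨hpos, hlt⟩ := ih (fun i => n (1 + i)) fun i _ _ => hn (1 + i) (by omega) (by omega)
    have h1 := hn 1 le_rfl (by omega)
    refine ⟨hpos.trans hlt, ?_⟩
    rw [HJMat_det_add_two]
    simp only [pow_succ] at *
    nlinarith [mul_nonneg (sub_nonneg.mpr h1) (hpos.trans hlt).le]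

theorem HJdet_eq_signed_det (l : ℕ) (n : ℕ → ℤ) (hn : ∀ i, 1 ≤ i → i ≤ l → 2 ≤ n i) :
    HJdet l n = (-1) ^ l * (HJMat l n).det := by
  have hpos : 0 < (-1) ^ l * (HJMat l n).det := by
    cases l with
    | zero => simp
    | succ l =>
      obtain ⟨hpos, hlt⟩ := HJMat_signed_det_pos_and_lt l n hn
      exact hpos.trans hlt
  rw [← abs_of_pos hpos, abs_mul, abs_pow]
  simp [HJdet]

theorem HJdet_pos_and_lt (l : ℕ) (n : ℕ → ℤ) (hn : ∀ i, 1 ≤ i → i ≤ l + 1 → 2 ≤ n i) :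
    0 < HJdet l (fun i => n (1 + i)) ∧ HJdet l (fun i => n (1 + i)) < HJdet (l + 1) n := by
  rw [HJdet_eq_signed_det (l + 1) n hn,
    HJdet_eq_signed_det l _ fun i _ _ => hn (1 + i) (by omega) (by omega)]
  exact HJMat_signed_det_pos_and_lt l n hn

theorem HJdet_add_two (l : ℕ) (n : ℕ → ℤ) (hn : ∀ i, 1 ≤ i → i ≤ l + 2 → 2 ≤ n i) :
    HJdet (l + 2) n = n 1 * HJdet (l + 1) (fun i => n (1 + i))
      - HJdet l (fun i => n (1 + (1 + i))) := by
  rw [HJdet_eq_signed_det (l + 2) n hn,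
    HJdet_eq_signed_det (l + 1) _ fun i _ _ => hn (1 + i) (by omega) (by omega),
    HJdet_eq_signed_det l _ fun i _ _ => hn (1 + (1 + i)) (by omega) (by omega),
    HJMat_det_add_two]
  ring

theorem eq_two_of_HJdet_succ_eq (l : ℕ) (n : ℕ → ℤ) (hn : ∀ i, 1 ≤ i → i ≤ l + 1 → 2 ≤ n i)
    (h : HJdet (l + 1) n = HJdet l (fun i => n (1 + i)) + 1) :
    ∀ i, 1 ≤ i → i ≤ l + 1 → n i = 2 := by
  induction l generalizing n with
  | zero =>
    intro i hi hi'
    obtain rfl : i = 1 := by omega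
    rw [HJdet_eq_signed_det _ n hn] at h
    simp [HJMat, HJdet] at h
    linarith
  | succ l ih =>
    have hn' : ∀ i, 1 ≤ i → i ≤ l + 1 → 2 ≤ n (1 + i) := fun i _ _ =>
      hn (1 + i) (by omega) (by omega)
    obtain ⟨hpos, hlt⟩ := HJdet_pos_and_lt l (fun i => n (1 + i)) hn'
    have h1 := hn 1 le_rfl (by omega)
    rw [HJdet_add_two l n hn] at h
    have h2 : n 1 = 2 := by
      by_contra hne
      have h3 : 3 ≤ n 1 := by omega
      nlinarith [mul_nonneg (sub_nonneg.mpr h3) (hpos.trans hlt).le]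
    rw [h2] at h
    have htail := ih (fun i => n (1 + i)) hn' (by linarith)
    intro i hi hi'
    obtain rfl | hi1 := eq_or_lt_of_le hi
    · exact h2
    · have := htail (i - 1) (by omega) (by omega)
      rwa [Nat.add_sub_cancel' hi] at this

/-- Proposition 3.14(4), computation: if `q = q₁ + 1` then
`[n₁, …, n_l] = [2, …, 2]`. -/
theorem hj_q_eq_q1_add_one (l : ℕ) (n : ℕ → ℤ) (hl : 1 ≤ l)
    (hn : ∀ i, 1 ≤ i → i ≤ l → 2 ≤ n i)
    (h : HJq l n = HJv l n 1 + 1) :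
    ∀ i, 1 ≤ i → i ≤ l → n i = 2 := by
  obtain ⟨k, rfl⟩ : ∃ k, l = k + 1 := ⟨l - 1, by omega⟩
  rw [HJq, HJv, if_pos hl, Nat.add_sub_cancel] at h
  exact eq_two_of_HJdet_succ_eq k n hn h
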